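/- For every complex number z such that z^2 ≠ -((l-1/2)π)^2 for all positive integers l, the hyperbolic tangent admits the pole expansion tanh(z) = Σ_{l=1}^∞ 2z / (z^2 + (l - 1/2)^2 π^2), where the series converges (absolutely). -/

import Mathlib

open Complex Real

lemma aux_summable (z : ℂ) : Summable (fun j : ℕ =>
      ‖2 * z / (z ^ 2 + ((j : ℂ) + 1 / 2) ^ 2 * (Real.pi : ℂ) ^ 2)‖) := by
  have hs : Summable (fun j : ℕ => 2 * ‖z‖ * (1 / ((j : ℝ) + 1) ^ 2)) := by
    apply Summable.mul_left
    have := (summable_nat_add_iff 1).mpr (Real.summable_one_div_nat_pow.mpr (one_lt_two))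
    simpa using this
  refine Summable.of_norm_bounded_eventually_nat hs ?_
  filter_upwards [Filter.eventually_ge_atTop ⌈‖z‖⌉₊] with j hj
  have hj' : ‖z‖ ≤ j := Nat.ceil_le.mp hj
  have h0 := norm_nonneg z
  have hpi := Real.pi_gt_three
  rw [norm_norm, norm_div, norm_mul, Complex.norm_ofNat, mul_one_div]
  apply div_le_div_of_nonneg_left (by positivity) (by positivity)
  have h1 : ‖((j : ℂ) + 1 / 2) ^ 2 * (Real.pi : ℂ) ^ 2‖ = ((j : ℝ) + 1 / 2) ^ 2 * Real.pi ^ 2 := by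
    have : ((j : ℂ) + 1 / 2) ^ 2 * (Real.pi : ℂ) ^ 2
        = ((((j : ℝ) + 1 / 2) ^ 2 * Real.pi ^ 2 : ℝ) : ℂ) := by push_cast; ring
    rw [this, Complex.norm_real, Real.norm_of_nonneg (by positivity)]
  have h2 := norm_sub_le_norm_add (((j : ℂ) + 1 / 2) ^ 2 * (Real.pi : ℂ) ^ 2) (z ^ 2)
  rw [add_comm (((j : ℂ) + 1 / 2) ^ 2 * (Real.pi : ℂ) ^ 2), h1, norm_pow] at h2
  have h3 : ((j : ℝ) + 1 / 2) ^ 2 * 9 ≤ ((j : ℝ) + 1 / 2) ^ 2 * Real.pi ^ 2 := by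
    gcongr; nlinarith
  have h4 : ‖z‖ ^ 2 ≤ (j : ℝ) ^ 2 := by gcongr
  have h5 : (0 : ℝ) ≤ j := by positivity
  nlinarith

theorem aux_tendsto (z : ℂ)
    (hz : ∀ l : ℕ+, z ^ 2 ≠ -((((l : ℂ) - 1 / 2) * (Real.pi : ℂ)) ^ 2)) :
    Filter.Tendsto (fun n : ℕ => ∑ j ∈ Finset.range n,
      2 * z / (z ^ 2 + ((j : ℂ) + 1 / 2) ^ 2 * (Real.pi : ℂ) ^ 2)) Filter.atTop
      (nhds (Complex.tanh z)) := by
  have hpi : (Real.pi : ℂ) ≠ 0 := by exact_mod_cast Real.pi_ne_zero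
  obtain ⟨x, hx⟩ : ∃ x : ℂ, x = 1 / 2 + I * z / Real.pi := ⟨_, rfl⟩
  have hzx : z = -I * Real.pi * (x - 1 / 2) := by
    rw [hx]; field_simp; linear_combination (2*z) * I_sq
  have hxZ : x ∈ Complex.integerComplement := by
    rintro ⟨k, hk⟩
    rcases le_or_gt 1 k with h | h
    · obtain ⟨m, rfl⟩ := Int.eq_ofNat_of_zero_le (by omega : 0 ≤ k)
      apply hz ⟨m, by omega⟩
      rw [hzx, ← hk]
      simp only [PNat.mk_coe, Int.cast_natCast, Int.ofNat_eq_natCast]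
      linear_combination ((Real.pi : ℂ) * (m - 1 / 2)) ^ 2 * I_sq
    · obtain ⟨m, hm⟩ := Int.eq_ofNat_of_zero_le (by omega : 0 ≤ 1 - k)
      apply hz ⟨m, by omega⟩
      have : (k : ℂ) = 1 - (m : ℂ) := by
        have h' : k = 1 - (m : ℤ) := by omega
        rw [h']; push_cast; ring
      rw [hzx, ← hk, this]
      simp only [PNat.mk_coe, Int.cast_natCast, Int.ofNat_eq_natCast]
      linear_combination ((Real.pi : ℂ) * (m - 1 / 2)) ^ 2 * I_sq
  have hne : ∀ k : ℤ, x + k ≠ 0 := fun k => Complex.integerComplement_add_ne_zero hxZ k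
  have hT : ∀ j : ℕ, 2 * z / (z ^ 2 + ((j : ℂ) + 1 / 2) ^ 2 * (Real.pi : ℂ) ^ 2)
      = I / Real.pi * (1 / (x - (j + 1)) + 1 / (x + j)) := by
    intro j
    have h1 : x - (j + 1) ≠ 0 := by
      have := hne (-(j + 1)); push_cast at this; rwa [sub_eq_add_neg]
    have h2 : x + j ≠ 0 := by exact_mod_cast hne j
    have h3 : z ^ 2 + ((j : ℂ) + 1 / 2) ^ 2 * (Real.pi : ℂ) ^ 2
        = -(Real.pi : ℂ) ^ 2 * ((x - (j + 1)) * (x + j)) := by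
      rw [hzx]; linear_combination ((Real.pi : ℂ) * (x - 1 / 2)) ^ 2 * I_sq
    rw [h3, hzx]
    field_simp
    ring
  have hsum : ∀ n : ℕ, ∑ j ∈ Finset.range n,
      2 * z / (z ^ 2 + ((j : ℂ) + 1 / 2) ^ 2 * (Real.pi : ℂ) ^ 2)
      = I / Real.pi * (1 / x + ∑ j ∈ Finset.range n, cotTerm x j - 1 / (x + n)) := by
    intro n
    induction n with
    | zero => simp
    | succ n ih =>
      rw [Finset.sum_range_succ, ih, hT, Finset.sum_range_succ, cotTerm]
      push_cast
      ring
  simp_rw [hsum]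
  have hlim : Filter.Tendsto (fun n : ℕ => 1 / (x + n)) Filter.atTop (nhds 0) := by
    simp_rw [one_div]
    apply Filter.Tendsto.comp Filter.tendsto_inv₀_cobounded
    exact (tendsto_const_add_cobounded x).comp tendsto_natCast_atTop_cobounded
  have := (((tendsto_logDeriv_euler_cot_sub hxZ).const_add (1 / x)).sub hlim).const_mul
    (I / Real.pi)
  convert this using 2
  have e : (Real.pi : ℂ) * x = z * I + Real.pi / 2 := by rw [hx]; field_simp; ring
  rw [e, Complex.cot, Complex.cos_add_pi_div_two, Complex.sin_add_pi_div_two,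
    Complex.sin_mul_I, Complex.cos_mul_I, Complex.tanh_eq_sinh_div_cosh]
  field_simp
  linear_combination (Real.pi * Complex.sinh z / Complex.cosh z) * I_sq

/-- Pole expansion of the complex hyperbolic tangent (pairwise-combined
Mittag-Leffler form): for every `z : ℂ` avoiding the poles of `tanh`,
`tanh z = ∑_{l=1}^∞ 2z / (z² + (l - 1/2)² π²)`, the series being
(absolutely) convergent. -/
theorem stmt_0 (z : ℂ)
    (hz : ∀ l : ℕ+, z ^ 2 ≠ -((((l : ℂ) - 1 / 2) * (Real.pi : ℂ)) ^ 2)) :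
    Summable (fun l : ℕ+ =>
      ‖2 * z / (z ^ 2 + ((l : ℂ) - 1 / 2) ^ 2 * (Real.pi : ℂ) ^ 2)‖) ∧
    HasSum (fun l : ℕ+ =>
      2 * z / (z ^ 2 + ((l : ℂ) - 1 / 2) ^ 2 * (Real.pi : ℂ) ^ 2))
      (Complex.tanh z) := by
  have hs := aux_summable z
  have key : ∀ n : ℕ, ((Equiv.pnatEquivNat.symm n : ℕ+) : ℂ) - 1 / 2 = (n : ℂ) + 1 / 2 := by
    intro n
    simp
    ring
  constructor
  · rw [← Equiv.pnatEquivNat.symm.summable_iff]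
    refine hs.congr fun n => ?_
    simp only [Function.comp, key]
  · rw [← Equiv.pnatEquivNat.symm.hasSum_iff]
    have h := (hs.of_norm.hasSum_iff_tendsto_nat).mpr (aux_tendsto z hz)
    refine h.congr_fun ?_ 
    intro n
    simp only [Function.comp, key]
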